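/- Let Π.φ be a quantified Horn formula, let C be a Horn clause with all variables among those of Π, and let i be the maximum level of the literals of C (the index of the rightmost quantifier block containing a variable of C). If the abstraction Π_i.(φ ∧ C̄) has an SLD-Q-resolution refutation, where C̄ denotes the conjunction of unit clauses {¬ℓ} for each literal ℓ of C, then Π_i.φ and Π_i.(φ ∧ C) are logically equivalent. -/

import Mathlib

attribute [local instance] Classical.propDecidable

namespace QHornProlog

/-- Propositional variables. -/
abbrev Var := ℕ
/-- A literal is a variable together with a polarity (`true` = positive). -/
abbrev Lit := Var × Bool
/-- A clause is a finite set of literals. -/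
abbrev Clause := Finset Lit
/-- A CNF formula is a finite set of clauses. -/
abbrev CNF := Finset Clause
/-- A Boolean assignment to the variables. -/
abbrev Assignment := Var → Bool

/-- An assignment makes a literal true. -/
def litSat (a : Assignment) (l : Lit) : Prop := a l.1 = l.2
/-- An assignment satisfies a clause if some literal of it is made true. -/
def clauseSat (a : Assignment) (C : Clause) : Prop := ∃ l ∈ C, litSat a l
/-- An assignment satisfies a CNF if it satisfies every clause. -/
def cnfSat (a : Assignment) (F : CNF) : Prop := ∀ C ∈ F, clauseSat a C
/-- A CNF formula is satisfiable if some assignment satisfies it. -/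
def CnfSatisfiable (F : CNF) : Prop := ∃ a, cnfSat a F

/-- The positive literals of a clause. -/
def posLits (C : Clause) : Clause := C.filter (fun l => l.2 = true)
/-- A Horn clause has at most one positive literal. -/
def IsHornClause (C : Clause) : Prop := (posLits C).card ≤ 1
/-- A definite Horn clause has exactly one positive literal. -/
def IsDefiniteClause (C : Clause) : Prop := (posLits C).card = 1
/-- A negative (goal) clause has only negative literals. -/
def IsNegativeClause (C : Clause) : Prop := ∀ l ∈ C, l.2 = false
/-- A Horn formula consists of Horn clauses. -/
def IsHornFormula (F : CNF) : Prop := ∀ C ∈ F, IsHornClause C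

/-- `R` is the resolvent of `C` and `D` on pivot `x`. -/
def IsResolvent (C D R : Clause) (x : Var) : Prop :=
  (x, true) ∈ C ∧ (x, false) ∈ D ∧ R = C.erase (x, true) ∪ D.erase (x, false)

/-- A unit resolution refutation of `F`: a sequence of clauses ending in the empty
clause, each either in `F` or a resolvent of two earlier clauses where at least one
premise is a unit clause. -/
def IsUnitResRefutation (F : CNF) (L : List Clause) : Prop :=
  L ≠ [] ∧ L.getLast? = some (∅ : Clause) ∧
  ∀ i (hi : i < L.length),
    L.get ⟨i, hi⟩ ∈ F ∨
    ∃ j k, ∃ (hj : j < i) (hk : k < i), ∃ x : Var,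
      ((L.get ⟨j, hj.trans hi⟩).card = 1 ∨ (L.get ⟨k, hk.trans hi⟩).card = 1) ∧
      IsResolvent (L.get ⟨j, hj.trans hi⟩) (L.get ⟨k, hk.trans hi⟩) (L.get ⟨i, hi⟩) x

/-- An SLD-resolution refutation of `F`: a sequence of negative clauses starting at a
goal clause of `F`, each next clause the resolvent of the previous (centre) clause with
a definite clause of `F` (side clause) on its head, ending in the empty clause. -/
def IsSLDRefutation (F : CNF) (L : List Clause) : Prop :=
  ∃ h : L ≠ [],
    L.head h ∈ F ∧ IsNegativeClause (L.head h) ∧ L.getLast h = (∅ : Clause) ∧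
    ∀ i (hi : i + 1 < L.length),
      ∃ C ∈ F, ∃ x : Var,
        posLits C = {(x, true)} ∧ (x, false) ∈ L.get ⟨i, Nat.lt_of_succ_lt hi⟩ ∧
        L.get ⟨i + 1, hi⟩ =
          (L.get ⟨i, Nat.lt_of_succ_lt hi⟩).erase (x, false) ∪ C.erase (x, true)

/-! ### Quantified Boolean formulas in closed prenex form -/

/-- A quantifier prefix: a list of blocks, each a quantifier (`true` = ∃, `false` = ∀)
together with a finite set of variables. -/
abbrev QPrefix := List (Bool × Finset Var)

/-- All variables occurring in the prefix. -/
def prefixVars (Pf : QPrefix) : Finset Var := Pf.foldr (fun p s => p.2 ∪ s) ∅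
/-- Variables of a clause. -/
def clauseVars (C : Clause) : Finset Var := C.image Prod.fst
/-- Variables of a CNF. -/
def cnfVars (F : CNF) : Finset Var := F.sup clauseVars

/-- Override an assignment on the set `X` by the assignment `b`. -/
def override (a : Assignment) (X : Finset Var) (b : Assignment) : Assignment :=
  fun v => if v ∈ X then b v else a v

/-- Recursive truth evaluation of a prenex QBF relative to an ambient assignment:
an ∃-block requires some assignment of its variables, a ∀-block requires all. -/
def QEval : QPrefix → CNF → Assignment → Prop
  | [], φ, a => cnfSat a φ
  | (true, X) :: Pf, φ, a => ∃ b, QEval Pf φ (override a X b)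
  | (false, X) :: Pf, φ, a => ∀ b, QEval Pf φ (override a X b)

/-- Truth of a closed prenex QBF. -/
def QTrue (Pf : QPrefix) (φ : CNF) : Prop := QEval Pf φ (fun _ => false)

/-- `Pf.φ` is a closed prenex QBF: the blocks are pairwise disjoint and every variable
of the matrix is quantified. -/
def ClosedQBF (Pf : QPrefix) (φ : CNF) : Prop :=
  Pf.Pairwise (fun p q => Disjoint p.2 q.2) ∧ cnfVars φ ⊆ prefixVars Pf

/-- A variable is existential if it lies in an ∃-block. -/
def IsExistential (Pf : QPrefix) (v : Var) : Prop := ∃ p ∈ Pf, p.1 = true ∧ v ∈ p.2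
/-- A variable is universal if it lies in a ∀-block. -/
def IsUniversal (Pf : QPrefix) (v : Var) : Prop := ∃ p ∈ Pf, p.1 = false ∧ v ∈ p.2
/-- A quantified Horn formula: a closed prenex QBF with a Horn matrix. -/
def IsQHorn (Pf : QPrefix) (φ : CNF) : Prop := ClosedQBF Pf φ ∧ IsHornFormula φ

/-- Variable `v` lies in block number `i` (0-indexed) of the prefix. -/
def hasLevel (Pf : QPrefix) (v : Var) (i : ℕ) : Prop :=
  ∃ h : i < Pf.length, v ∈ (Pf.get ⟨i, h⟩).2
/-- Variable `v` is at or to the left of variable `w` in the prefix ordering. -/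
def levelLE (Pf : QPrefix) (v w : Var) : Prop :=
  ∃ i j, i ≤ j ∧ hasLevel Pf v i ∧ hasLevel Pf w j

/-- Clauses of the matrix with exactly one positive literal, which is existential. -/
noncomputable def Fexist (Pf : QPrefix) (φ : CNF) : CNF :=
  φ.filter (fun C => ∃ x, posLits C = {(x, true)} ∧ IsExistential Pf x)
/-- Clauses of the matrix with exactly one positive literal, which is universal. -/
noncomputable def Fforall (Pf : QPrefix) (φ : CNF) : CNF :=
  φ.filter (fun C => ∃ x, posLits C = {(x, true)} ∧ IsUniversal Pf x)
/-- Goal clauses: clauses with only negative literals. -/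
noncomputable def Fgoal (φ : CNF) : CNF := φ.filter IsNegativeClause

/-- One SLD-Q-resolution step from centre clause `N` to `N'`: either resolution with a
definite clause of `φ` on its existential head, or universal reduction of a universal
literal not blocked by any existential literal at or to its right. -/
def SLDQStep (Pf : QPrefix) (φ : CNF) (N N' : Clause) : Prop :=
  (∃ C ∈ φ, ∃ x : Var, posLits C = {(x, true)} ∧ IsExistential Pf x ∧
     (x, false) ∈ N ∧ N' = N.erase (x, false) ∪ C.erase (x, true)) ∨
  (∃ l ∈ N, IsUniversal Pf l.1 ∧
     (∀ k ∈ N, IsExistential Pf k.1 → ¬ levelLE Pf l.1 k.1) ∧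
     N' = N.erase l)

/-- An SLD-Q-resolution refutation of `Pf.φ`: a sequence of negative clauses starting
at a goal clause of `φ`, proceeding by SLD-Q-resolution steps, ending in the empty
clause. -/
def IsSLDQRefutation (Pf : QPrefix) (φ : CNF) (L : List Clause) : Prop :=
  ∃ h : L ≠ [],
    L.head h ∈ φ ∧ IsNegativeClause (L.head h) ∧ L.getLast h = (∅ : Clause) ∧
    ∀ i (hi : i + 1 < L.length),
      SLDQStep Pf φ (L.get ⟨i, Nat.lt_of_succ_lt hi⟩) (L.get ⟨i + 1, hi⟩)

/-! ### Skolem-function models and logical equivalence -/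

/-- A family of candidate Skolem functions: to every variable a function from
assignments to Booleans. -/
abbrev SkolemFamily := Var → Assignment → Bool

/-- Variables of the first `i` blocks of the prefix. -/
def varsUpTo (Pf : QPrefix) (i : ℕ) : Finset Var := prefixVars (Pf.take i)

/-- Each Skolem function for an existential variable depends only on the variables
quantified to the left of it (i.e. in strictly earlier blocks). -/
def DependsOnlyOuter (Pf : QPrefix) (σ : SkolemFamily) : Prop :=
  ∀ i (hi : i < Pf.length), (Pf.get ⟨i, hi⟩).1 = true →
    ∀ v ∈ (Pf.get ⟨i, hi⟩).2, ∀ a b : Assignment,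
      (∀ w ∈ varsUpTo Pf i, a w = b w) → σ v a = σ v b

/-- A complete assignment is consistent with the Skolem family if every existential
variable takes the value prescribed by its Skolem function. -/
def ConsistentWith (Pf : QPrefix) (σ : SkolemFamily) (a : Assignment) : Prop :=
  ∀ v, IsExistential Pf v → a v = σ v a

/-- `σ` is a model of `Pf.φ`: its functions depend only on outer variables and every
consistent complete assignment satisfies the matrix. -/
def IsModel (Pf : QPrefix) (φ : CNF) (σ : SkolemFamily) : Prop :=
  DependsOnlyOuter Pf σ ∧ ∀ a : Assignment, ConsistentWith Pf σ a → cnfSat a φ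

/-- Two QBFs with the same prefix are logically equivalent iff they have exactly the
same models. -/
def LogEquiv (Pf : QPrefix) (φ φ' : CNF) : Prop :=
  ∀ σ : SkolemFamily, IsModel Pf φ σ ↔ IsModel Pf φ' σ

/-- The abstraction `Pf_i`: all variables of the first `i` blocks are made existential
and put in a single leading ∃-block. -/
def abstraction (Pf : QPrefix) (i : ℕ) : QPrefix :=
  (true, varsUpTo Pf i) :: Pf.drop i

/-- The complement of a literal. -/
def negLit (l : Lit) : Lit := (l.1, !l.2)

/-- `C̄`: the conjunction (CNF) of unit clauses `{¬ℓ}` for the literals `ℓ` of `C`. -/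
def negUnits (C : Clause) : CNF := C.image (fun l => ({negLit l} : Clause))

/-- The outer clause `OC(Pf, D, m)`: literals of `D` other than `m` at or to the left
of `m`. -/
noncomputable def outerClause (Pf : QPrefix) (D : Clause) (m : Lit) : Clause :=
  (D.erase m).filter (fun k => levelLE Pf k.1 m.1)

/-- The outer resolvent `OR(Pf, C, D, ℓ)`. -/
noncomputable def outerResolvent (Pf : QPrefix) (C D : Clause) (l : Lit) : Clause :=
  C.erase l ∪ outerClause Pf D (negLit l)

/-- Property QIOR⁺ of a clause `C` on literal `ℓ ∈ C` with respect to `Pf.ψ`. -/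
def QIORplus (Pf : QPrefix) (ψ : CNF) (C : Clause) (l : Lit) : Prop :=
  l ∈ C ∧ ∀ D ∈ ψ, negLit l ∈ D → LogEquiv Pf ψ (insert (outerResolvent Pf C D l) ψ)

/-- Restrict every block of a prefix to the variable set `V`. -/
def restrictPrefix (Pf : QPrefix) (V : Finset Var) : QPrefix :=
  Pf.map (fun p => (p.1, p.2 ∩ V))

/-- Normal form of a prefix: drop empty blocks and merge adjacent blocks carrying the
same quantifier. -/
def normalize : QPrefix → QPrefix
  | [] => []
  | p :: Pf =>
    let r := normalize Pf
    if p.2 = ∅ then r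
    else
      match r with
      | [] => [p]
      | q :: r' => if p.1 = q.1 then (p.1, p.2 ∪ q.2) :: r' else p :: q :: r'

/-- `Pf'` extends `Pf` by the new variables `S`, placed arbitrarily in the prefix:
the variables of `Pf'` are those of `Pf` together with `S`, and removing `S` from
`Pf'` gives back `Pf` (up to empty blocks and block splitting). -/
def PrefixExtends (Pf Pf' : QPrefix) (S : Finset Var) : Prop :=
  Disjoint (prefixVars Pf) S ∧
  prefixVars Pf' = prefixVars Pf ∪ S ∧
  normalize (restrictPrefix Pf' (prefixVars Pf)) = normalize Pf

/-- Renaming of a literal with respect to a set `S` of variables. -/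
def renameLit (S : Finset Var) (l : Lit) : Lit := if l.1 ∈ S then negLit l else l
/-- Renaming of a clause. -/
def renameClause (S : Finset Var) (C : Clause) : Clause := C.image (renameLit S)
/-- Renaming of a CNF matrix. -/
def renameCNF (S : Finset Var) (φ : CNF) : CNF := φ.image (renameClause S)


theorem mem_prefixVars {Pf : QPrefix} {v : Var} :
    v ∈ prefixVars Pf ↔ ∃ p ∈ Pf, v ∈ p.2 := by
  induction Pf with
  | nil => simp [prefixVars]
  | cons q Pf ih =>
    have h : prefixVars (q :: Pf) = q.2 ∪ prefixVars Pf := rfl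
    simp [h, ih]

theorem mem_varsUpTo {Pf : QPrefix} {j : ℕ} {v : Var} :
    v ∈ varsUpTo Pf j ↔ ∃ m, ∃ h : m < Pf.length, m < j ∧ v ∈ (Pf[m]).2 := by
  simp only [varsUpTo, mem_prefixVars, List.mem_iff_getElem, List.length_take]
  constructor
  · rintro ⟨p, ⟨m, hm, rfl⟩, hv⟩
    refine ⟨m, by omega, by omega, ?_⟩
    simpa using hv
  · rintro ⟨m, h, hmj, hv⟩
    exact ⟨Pf[m], ⟨m, by omega, by simp⟩, hv⟩

/-- The blocks of an abstraction are pairwise disjoint if those of the prefix are. -/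
theorem pairwise_disjoint_abstraction {Pf : QPrefix}
    (hd : Pf.Pairwise (fun p q => Disjoint p.2 q.2)) (i : ℕ) :
    (abstraction Pf i).Pairwise (fun p q => Disjoint p.2 q.2) := by
  rw [← List.take_append_drop i Pf, List.pairwise_append] at hd
  refine List.pairwise_cons.2 ⟨fun q hq => ?_, hd.2.1⟩
  refine Finset.disjoint_left.2 fun v hv hvq => ?_
  obtain ⟨p, hp, hvp⟩ := mem_prefixVars.1 hv
  exact Finset.disjoint_left.1 (hd.2.2 p hp q hq) hvp hvq

theorem block_index_unique {Pf : QPrefix}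
    (hd : Pf.Pairwise (fun p q => Disjoint p.2 q.2)) {m k : ℕ}
    (hm : m < Pf.length) (hk : k < Pf.length) {v : Var}
    (hvm : v ∈ (Pf[m]).2) (hvk : v ∈ (Pf[k]).2) : m = k := by
  rw [List.pairwise_iff_getElem] at hd
  rcases lt_trichotomy m k with h | h | h
  · exact absurd hvk (Finset.disjoint_left.1 (hd m k hm hk h) hvm)
  · exact h
  · exact absurd hvm (Finset.disjoint_left.1 (hd k m hk hm h) hvk)

/-- A consistent assignment stays consistent when a universal variable is given a new
value and the existential variables to its right are recomputed. -/
theorem exists_consistent_update {Pf : QPrefix}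
    (hd : Pf.Pairwise (fun p q => Disjoint p.2 q.2)) {σ : SkolemFamily}
    (hσ : DependsOnlyOuter Pf σ) {a : Assignment} (ha : ConsistentWith Pf σ a)
    {k : ℕ} (hk : k < Pf.length) (hk_univ : (Pf[k]).1 = false) {u : Var}
    (hu : u ∈ (Pf[k]).2) (c : Bool) :
    ∃ b, ConsistentWith Pf σ b ∧ b u = c ∧
      ∀ v, v ≠ u → (∀ m (hm : m < Pf.length), k ≤ m → (Pf[m]).1 = true → v ∉ (Pf[m]).2) →
        b v = a v := by
  have key : ∀ j, k + 1 ≤ j →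
      ∃ b : Assignment,
        (∀ m (hm : m < Pf.length), m < j → (Pf[m]).1 = true → ∀ v ∈ (Pf[m]).2, b v = σ v b) ∧
        b u = c ∧
        ∀ v, v ≠ u →
          (∀ m (hm : m < Pf.length), k ≤ m → (Pf[m]).1 = true → v ∉ (Pf[m]).2) → b v = a v := by
    intro j hj
    induction j, hj using Nat.le_induction with
    | base =>
      refine ⟨Function.update a u c, fun m hm hmk hm_ex v hv => ?_, by simp, fun v hvu _ => by
        simp [hvu]⟩
      have hne : m ≠ k := by
        rintro rfl
        simp [hk_univ] at hm_ex
      have hvu : v ≠ u := by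
        rintro rfl
        exact hne (block_index_unique hd hm hk hv hu)
      rw [Function.update_of_ne hvu, ha v ⟨Pf[m], List.getElem_mem hm, hm_ex, hv⟩]
      refine hσ m hm hm_ex v hv _ _ fun w hw => ?_
      obtain ⟨l, hl, hlm, hwl⟩ := mem_varsUpTo.1 hw
      have hwu : w ≠ u := by
        rintro rfl
        have := block_index_unique hd hl hk hwl hu
        omega
      rw [Function.update_of_ne hwu]
    | succ j hj ih =>
      obtain ⟨b, hb, hbu, hba⟩ := ih
      by_cases hex : ∃ h : j < Pf.length, (Pf[j]).1 = true
      · obtain ⟨hjl, hj_ex⟩ := hex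
        have outer : ∀ m (hm : m < Pf.length), m ≤ j → (Pf[m]).1 = true → ∀ v ∈ (Pf[m]).2,
            σ v (override b (Pf[j]).2 (fun v => σ v b)) = σ v b := by
          intro m hm hmj hm_ex v hv
          refine hσ m hm hm_ex v hv _ _ fun w hw => ?_
          obtain ⟨l, hl, hlm, hwl⟩ := mem_varsUpTo.1 hw
          have hwj : w ∉ (Pf[j]).2 := fun hwj => by
            have := block_index_unique hd hl hjl hwl hwj
            omega
          simp [override, hwj]
        refine ⟨override b (Pf[j]).2 (fun v => σ v b), fun m hm hmj hm_ex v hv => ?_, ?_,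
          fun v hvu hv => ?_⟩
        · rw [outer m hm (by omega) hm_ex v hv]
          by_cases hvj : v ∈ (Pf[j]).2
          · simp [override, hvj]
          · have hmj' : m ≠ j := by
              rintro rfl
              exact hvj hv
            simpa [override, hvj] using hb m hm (by omega) hm_ex v hv
        · have huj : u ∉ (Pf[j]).2 := fun huj => by
            have := block_index_unique hd hk hjl hu huj
            omega
          simpa [override, huj] using hbu
        · have hvj : v ∉ (Pf[j]).2 := hv j hjl (by omega) hj_ex
          simpa [override, hvj] using hba v hvu hv
      · refine ⟨b, fun m hm hmj hm_ex v hv => ?_, hbu, hba⟩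
        have hmj' : m ≠ j := by
          rintro rfl
          exact hex ⟨hm, hm_ex⟩
        exact hb m hm (by omega) hm_ex v hv
  obtain ⟨b, hb, hbu, hba⟩ := key Pf.length (by omega)
  refine ⟨b, ?_, hbu, hba⟩
  rintro v ⟨p, hp, hp_ex, hv⟩
  obtain ⟨m, hm, rfl⟩ := List.mem_iff_getElem.1 hp
  exact hb m hm hm hp_ex v hv

theorem SLDQStep.isNegativeClause {Pf : QPrefix} {φ : CNF} {N N' : Clause}
    (h : SLDQStep Pf φ N N') (hN : IsNegativeClause N) : IsNegativeClause N' := by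
  rcases h with ⟨C, -, x, hpos, -, -, rfl⟩ | ⟨l, -, -, -, rfl⟩
  · intro l hl
    rcases Finset.mem_union.1 hl with hl | hl
    · exact hN l (Finset.mem_of_mem_erase hl)
    · obtain ⟨hne, hl⟩ := Finset.mem_erase.1 hl
      by_contra hl_pos
      have hmem : l ∈ posLits C := Finset.mem_filter.2 ⟨hl, by simpa using hl_pos⟩
      rw [hpos] at hmem
      exact hne (Finset.mem_singleton.1 hmem)
  · exact fun k hk => hN k (Finset.mem_of_mem_erase hk)

/-- Resolution and universal reduction preserve satisfaction by all assignments
consistent with a model. -/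
theorem SLDQStep.sound {Pf : QPrefix} (hd : Pf.Pairwise (fun p q => Disjoint p.2 q.2))
    {φ : CNF} {σ : SkolemFamily} (hσ : IsModel Pf φ σ) {N N' : Clause}
    (h : SLDQStep Pf φ N N') (hneg : IsNegativeClause N)
    (hN : ∀ a, ConsistentWith Pf σ a → clauseSat a N) :
    ∀ a, ConsistentWith Pf σ a → clauseSat a N' := by
  intro a ha
  rcases h with ⟨C, hC, x, -, -, -, rfl⟩ | ⟨l, hl, ⟨p, hp, hp_univ, hlp⟩, hright, rfl⟩
  · obtain ⟨l, hl, hla⟩ := hN a ha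
    obtain ⟨k, hk, hka⟩ := hσ.2 a ha C hC
    by_cases hlx : l = (x, false)
    · refine ⟨k, Finset.mem_union_right _ (Finset.mem_erase.2 ⟨?_, hk⟩), hka⟩
      rintro rfl
      subst hlx
      simp_all [litSat]
    · exact ⟨l, Finset.mem_union_left _ (Finset.mem_erase.2 ⟨hlx, hl⟩), hla⟩
  · obtain ⟨j, hj, rfl⟩ := List.mem_iff_getElem.1 hp
    obtain ⟨b, hb, hbl, hba⟩ := exists_consistent_update hd hσ.1 ha hj hp_univ hlp true
    obtain ⟨k, hk, hkb⟩ := hN b hb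
    have hkl : k.1 ≠ l.1 := by
      intro h
      have := hneg k hk
      simp_all [litSat]
    refine ⟨k, Finset.mem_erase.2 ⟨fun h => hkl (h ▸ rfl), hk⟩, ?_⟩
    have hka : b k.1 = a k.1 := hba k.1 hkl fun m hm hjm hm_ex hkm =>
      hright k hk ⟨Pf[m], List.getElem_mem hm, hm_ex, hkm⟩ ⟨j, m, hjm, ⟨hj, hlp⟩, ⟨hm, hkm⟩⟩
    exact hka.symm.trans hkb

/-- A refutable formula has no model that admits a consistent assignment. -/
theorem IsSLDQRefutation.not_consistent {Pf : QPrefix}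
    (hd : Pf.Pairwise (fun p q => Disjoint p.2 q.2)) {φ : CNF} {L : List Clause}
    (hL : IsSLDQRefutation Pf φ L) {σ : SkolemFamily} (hσ : IsModel Pf φ σ)
    (a : Assignment) : ¬ ConsistentWith Pf σ a := by
  intro ha
  obtain ⟨hne, hmem, hneg, hlast, hstep⟩ := hL
  have inv : ∀ j (hj : j < L.length), IsNegativeClause L[j] ∧
      ∀ a, ConsistentWith Pf σ a → clauseSat a L[j] := by
    intro j
    induction j with
    | zero =>
      intro hj
      rw [List.head_eq_getElem] at hmem hneg
      exact ⟨hneg, fun a ha => hσ.2 a ha _ hmem⟩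
    | succ j ih =>
      intro hj
      obtain ⟨hn, hs⟩ := ih (by omega)
      exact ⟨(hstep j hj).isNegativeClause hn, (hstep j hj).sound hd hσ hn hs⟩
  have hpos := List.length_pos_iff.2 hne
  obtain ⟨l, hl, -⟩ := (inv (L.length - 1) (by omega)).2 a ha
  rw [← List.getLast_eq_getElem hne, hlast] at hl
  simp at hl

/-- Let `Pf.φ` be a quantified Horn formula, `C` a Horn clause over
the variables of `Pf`, and `i` the maximum (1-indexed) level of the literals of
`C` (so every literal lies in some block of 0-indexed position `< i`, and some
literal lies in block `i-1`). If the abstraction `Pf_i.(φ ∧ C̄)` has an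
SLD-Q-resolution refutation, then `Pf_i.φ` and `Pf_i.(φ ∧ C)` are logically
equivalent. -/
theorem statement_11 (Pf : QPrefix) (φ : CNF) (hQH : IsQHorn Pf φ)
    (C : Clause) (hHorn : IsHornClause C) (hvars : clauseVars C ⊆ prefixVars Pf)
    (i : ℕ)
    (hub : ∀ l ∈ C, ∀ j, hasLevel Pf l.1 j → j + 1 ≤ i)
    (hmax : ∃ l ∈ C, hasLevel Pf l.1 (i - 1))
    (href : ∃ L : List Clause,
      IsSLDQRefutation (abstraction Pf i) (φ ∪ negUnits C) L) :
    LogEquiv (abstraction Pf i) φ (insert C φ) := by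
  have hd := pairwise_disjoint_abstraction hQH.1.1 i
  intro σ
  refine ⟨fun hσ => ⟨hσ.1, fun a ha D hD => ?_⟩,
    fun hσ => ⟨hσ.1, fun a ha D hD => hσ.2 a ha D (Finset.mem_insert_of_mem hD)⟩⟩
  rcases Finset.mem_insert.1 hD with rfl | hD
  swap
  · exact hσ.2 a ha D hD
  by_contra hunsat
  obtain ⟨L, hL⟩ := href
  refine hL.not_consistent hd (σ := σ) ⟨hσ.1, fun b hb E hE => ?_⟩ a ha
  rcases Finset.mem_union.1 hE with hE | hE
  · exact hσ.2 b hb E hE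
  obtain ⟨l, hl, rfl⟩ := Finset.mem_image.1 hE
  have hvar : l.1 ∈ varsUpTo Pf i := by
    obtain ⟨p, hp, hlp⟩ := mem_prefixVars.1 (hvars (Finset.mem_image_of_mem _ hl))
    obtain ⟨j, hj, rfl⟩ := List.mem_iff_getElem.1 hp
    exact mem_varsUpTo.2 ⟨j, hj, hub l hl j ⟨hj, hlp⟩, hlp⟩
  have hex : IsExistential (abstraction Pf i) l.1 :=
    ⟨_, List.mem_cons_self, rfl, hvar⟩
  have hconst : σ l.1 b = σ l.1 a :=
    hσ.1 0 (Nat.succ_pos _) rfl l.1 hvar b a (by simp [varsUpTo, prefixVars])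
  have hba : b l.1 = a l.1 := by rw [hb _ hex, ha _ hex, hconst]
  have hal : a l.1 ≠ l.2 := fun h => hunsat ⟨l, hl, h⟩
  refine ⟨negLit l, Finset.mem_singleton_self _, ?_⟩
  simpa [litSat, negLit, hba, Bool.eq_not] using hal

end QHornProlog
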